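/- arXiv:1808.10314 — 2 statements merged into one kernel-verified Lean document; each statement's English description precedes it below -/
import Mathlib

section
/- For every integer q ≥ 2 and every even integer V ≥ 2, the maximum of F(G) over all SYK graphs G with |V(G)| = V exists and equals q + (q−1)·(V−2)/2. -/
namespace SYK

/-- A pre-SYK graph: a finite nonempty vertex set `V`, darts `V × Fin q`
(`Fin q` standing for the strand labels `{1,…,q}`), a fixed-point-free
involutive fermionic pairing `ferm` of the darts, and a fixed-point-free
involutive disorder pairing `dis` of the vertices.  (Connectivity of the
fermionic multigraph is *not* required.) -/
structure PreGraph (q : ℕ) where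
  V : Type
  [fintypeV : Fintype V]
  [decEqV : DecidableEq V]
  [nonemptyV : Nonempty V]
  ferm : Equiv.Perm (V × Fin q)
  dis : Equiv.Perm V
  ferm_invol : ∀ d, ferm (ferm d) = d
  ferm_fpf : ∀ d, ferm d ≠ d
  dis_invol : ∀ v, dis (dis v) = v
  dis_fpf : ∀ v, dis v ≠ v

attribute [instance] PreGraph.fintypeV PreGraph.decEqV PreGraph.nonemptyV

variable {q : ℕ}

/-- The darts of a pre-SYK graph. -/
abbrev PreGraph.Dart (H : PreGraph q) : Type := H.V × Fin q

/-- Relabelling of darts induced by a map of vertices. -/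
def dartMap {q : ℕ} {α β : Type} (ι : α → β) (d : α × Fin q) : β × Fin q :=
  (ι d.1, d.2)

/-- The involution `π̂` on darts induced by the disorder pairing:
`π̂ (v, m) = (π v, m)`. -/
def PreGraph.dishat (H : PreGraph q) : Equiv.Perm H.Dart :=
  Equiv.prodCongr H.dis (Equiv.refl (Fin q))

/-- Adjacency of vertices in the fermionic multigraph `G₀`, where fermionic
lines having a dart in `S` are deleted. -/
def PreGraph.adj0Off (H : PreGraph q) (S : Set H.Dart) (v w : H.V) : Prop :=
  ∃ m m' : Fin q, (v, m) ∉ S ∧ H.ferm (v, m) = (w, m')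

/-- Adjacency of vertices in the fermionic multigraph `G₀`. -/
def PreGraph.adj0 (H : PreGraph q) : H.V → H.V → Prop :=
  H.adj0Off ∅

/-- Connectivity of the fermionic multigraph `G₀`. -/
def PreGraph.Conn0 (H : PreGraph q) : Prop :=
  ∀ v w : H.V, Relation.ReflTransGen H.adj0 v w

/-- Adjacency of vertices in the multigraph `G⁺` (one edge per fermionic line
and one edge per disorder line), where fermionic lines having a dart in `S`
are deleted. -/
def PreGraph.adjPlusOff (H : PreGraph q) (S : Set H.Dart) (v w : H.V) : Prop :=
  H.adj0Off S v w ∨ H.dis v = w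

/-- The subgroup of dart permutations generated by the fermionic pairing `τ`
and the induced disorder involution `π̂`; faces are its orbits. -/
def PreGraph.faceGroup (H : PreGraph q) : Subgroup (Equiv.Perm H.Dart) :=
  Subgroup.closure {H.ferm, H.dishat}

/-- Two darts lie in a common face. -/
def PreGraph.SameFace (H : PreGraph q) (d₁ d₂ : H.Dart) : Prop :=
  d₁ ∈ MulAction.orbit H.faceGroup d₂

/-- `F H`: the number of faces, i.e. of orbits of `⟨τ, π̂⟩` on the darts. -/
noncomputable def PreGraph.F (H : PreGraph q) : ℕ :=
  Nat.card (MulAction.orbitRel.Quotient H.faceGroup H.Dart)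

/-- The number of vertices `|V(H)|`. -/
noncomputable def PreGraph.nV (H : PreGraph q) : ℕ :=
  Nat.card H.V

/-- `δ(H) = F(H) − (q−1)·|V(H)|/2` (the division is exact: `|V(H)|` is even). -/
noncomputable def PreGraph.delta (H : PreGraph q) : ℤ :=
  (H.F : ℤ) - ((q : ℤ) - 1) * ((H.nV / 2 : ℕ) : ℤ)

/-- `e` is a fermionic line: the set of the two darts of a `τ`-orbit. -/
def PreGraph.IsLine (H : PreGraph q) (e : Set H.Dart) : Prop :=
  ∃ d : H.Dart, e = {d, H.ferm d}

/-- The fermionic lines `e₁` and `e₂` belong to a common face. -/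
def PreGraph.LinesShareFace (H : PreGraph q) (e₁ e₂ : Set H.Dart) : Prop :=
  ∃ d₁ ∈ e₁, ∃ d₂ ∈ e₂, H.SameFace d₁ d₂

/-- Deleting the fermionic lines with a dart in `S` disconnects `G₀`. -/
def PreGraph.Disconnects0 (H : PreGraph q) (S : Set H.Dart) : Prop :=
  ¬ ∀ v w : H.V, Relation.ReflTransGen (H.adj0Off S) v w

/-- Deleting the fermionic lines with a dart in `S` disconnects `G⁺`. -/
def PreGraph.DisconnectsPlus (H : PreGraph q) (S : Set H.Dart) : Prop :=
  ¬ ∀ v w : H.V, Relation.ReflTransGen (H.adjPlusOff S) v w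

/-- `{e₁, e₂}` is a 2-cut of the multigraph `G⁺`. -/
def PreGraph.TwoCutPlus (H : PreGraph q) (e₁ e₂ : Set H.Dart) : Prop :=
  H.DisconnectsPlus (e₁ ∪ e₂)

/-- `{e₁, e₂}` is a 2-cut of the fermionic multigraph `G₀`. -/
def PreGraph.TwoCut0 (H : PreGraph q) (e₁ e₂ : Set H.Dart) : Prop :=
  H.Disconnects0 (e₁ ∪ e₂)

/-- An SYK graph: a pre-SYK graph whose fermionic multigraph `G₀` is
connected. -/
structure Graph (q : ℕ) extends PreGraph q where
  conn : toPreGraph.Conn0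

/-- `G` is (a relabelling of) the minimal graph `G_min`: two vertices `a, b`
with `π a = b` and `τ (a, m) = (b, m)` for all `m`. -/
def Graph.IsMin (G : Graph q) : Prop :=
  ∃ a b : G.V, a ≠ b ∧ (∀ v : G.V, v = a ∨ v = b) ∧ G.dis a = b ∧
    ∀ m : Fin q, G.ferm (a, m) = (b, m)

/-- `G'` is obtained from `G` by a melonic move: two new vertices `x, y` with
`π x = y` are inserted on a fermionic line `{d, τ d}` of `G`; the strand
`⟨0, _⟩ : Fin q` plays the role of the label `1` of `{1,…,q}`. -/
def Graph.MelonicMove (G G' : Graph q) : Prop :=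
  ∃ (x y : G'.V) (ι : G.V → G'.V) (d : G.V × Fin q),
    Function.Injective ι ∧ x ≠ y ∧
    (∀ v' : G'.V, (¬ ∃ v, ι v = v') ↔ (v' = x ∨ v' = y)) ∧
    G'.dis x = y ∧
    (∀ v, G'.dis (ι v) = ι (G.dis v)) ∧
    G'.ferm (dartMap ι d) = (x, ⟨0, d.2.pos⟩) ∧
    G'.ferm (y, ⟨0, d.2.pos⟩) = dartMap ι (G.ferm d) ∧
    (∀ k : Fin q, k ≠ ⟨0, d.2.pos⟩ → G'.ferm (x, k) = (y, k)) ∧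
    (∀ d' : G.V × Fin q, d' ≠ d → d' ≠ G.ferm d →
      G'.ferm (dartMap ι d') = dartMap ι (G.ferm d'))

/-- Isomorphism of SYK graphs: a bijection of darts commuting with the
fermionic pairings and the induced disorder involutions, and mapping the `q`
darts of each vertex onto the `q` darts of a single vertex. -/
def Graph.Isomorphic (G G' : Graph q) : Prop :=
  ∃ φ : (G.V × Fin q) ≃ (G'.V × Fin q),
    (∀ d, φ (G.ferm d) = G'.ferm (φ d)) ∧
    (∀ d, φ (G.toPreGraph.dishat d) = G'.toPreGraph.dishat (φ d)) ∧
    ∀ v : G.V, ∃ v' : G'.V, ∀ m : Fin q, (φ (v, m)).1 = v'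

/-- `G` is melonic: isomorphic to a graph obtained from the minimal graph
`G_min` by a finite sequence of melonic moves. -/
def Graph.IsMelonic (G : Graph q) : Prop :=
  ∃ G₀ Gn : Graph q, G₀.IsMin ∧ Relation.ReflTransGen Graph.MelonicMove G₀ Gn ∧
    G.Isomorphic Gn


/-- The pre-SYK graph obtained from `H` by replacing the fermionic pairing,
keeping the vertex set and the disorder pairing. -/
def PreGraph.withFerm (H : PreGraph q) (f : Equiv.Perm (H.V × Fin q))
    (hi : ∀ d, f (f d) = d) (hf : ∀ d, f d ≠ d) : PreGraph q where
  V := H.V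
  fintypeV := H.fintypeV
  decEqV := H.decEqV
  nonemptyV := H.nonemptyV
  ferm := f
  dis := H.dis
  ferm_invol := hi
  ferm_fpf := hf
  dis_invol := H.dis_invol
  dis_fpf := H.dis_fpf

/-- `G` is the gluing `G₁^{(e₁)} ⋆ G₂^{(e₂)}` where `e₁ = {d₁, τ₁ d₁}` and
`e₂ = {d₂, τ₂ d₂}`: the vertex set is the disjoint union of those of `G₁` and
`G₂`, the disorder pairing is the union of the two disorder pairings, and the
fermionic pairing agrees with `τ₁`, `τ₂` outside `e₁ ∪ e₂` and pairs `d₁` with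
`d₂`, and `τ₁ d₁` with `τ₂ d₂`. -/
def Graph.IsStarGluing (G₁ G₂ G : Graph q) (d₁ : G₁.V × Fin q)
    (d₂ : G₂.V × Fin q) : Prop :=
  ∃ (ι₁ : G₁.V → G.V) (ι₂ : G₂.V → G.V),
    Function.Injective ι₁ ∧ Function.Injective ι₂ ∧
    (∀ v₁ v₂, ι₁ v₁ ≠ ι₂ v₂) ∧
    (∀ v : G.V, (∃ v₁, ι₁ v₁ = v) ∨ (∃ v₂, ι₂ v₂ = v)) ∧
    (∀ v, G.dis (ι₁ v) = ι₁ (G₁.dis v)) ∧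
    (∀ v, G.dis (ι₂ v) = ι₂ (G₂.dis v)) ∧
    G.ferm (dartMap ι₁ d₁) = dartMap ι₂ d₂ ∧
    G.ferm (dartMap ι₁ (G₁.ferm d₁)) = dartMap ι₂ (G₂.ferm d₂) ∧
    (∀ d, d ≠ d₁ → d ≠ G₁.ferm d₁ →
      G.ferm (dartMap ι₁ d) = dartMap ι₁ (G₁.ferm d)) ∧
    (∀ d, d ≠ d₂ → d ≠ G₂.ferm d₂ →
      G.ferm (dartMap ι₂ d) = dartMap ι₂ (G₂.ferm d))

/-- `G` is the gluing `G₁^{(e₁)} ⋆̄ G₂^{(e₂)}`: as in `IsStarGluing` but the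
fermionic pairing pairs `d₁` with `τ₂ d₂`, and `τ₁ d₁` with `d₂`. -/
def Graph.IsBarGluing (G₁ G₂ G : Graph q) (d₁ : G₁.V × Fin q)
    (d₂ : G₂.V × Fin q) : Prop :=
  ∃ (ι₁ : G₁.V → G.V) (ι₂ : G₂.V → G.V),
    Function.Injective ι₁ ∧ Function.Injective ι₂ ∧
    (∀ v₁ v₂, ι₁ v₁ ≠ ι₂ v₂) ∧
    (∀ v : G.V, (∃ v₁, ι₁ v₁ = v) ∨ (∃ v₂, ι₂ v₂ = v)) ∧
    (∀ v, G.dis (ι₁ v) = ι₁ (G₁.dis v)) ∧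
    (∀ v, G.dis (ι₂ v) = ι₂ (G₂.dis v)) ∧
    G.ferm (dartMap ι₁ d₁) = dartMap ι₂ (G₂.ferm d₂) ∧
    G.ferm (dartMap ι₁ (G₁.ferm d₁)) = dartMap ι₂ d₂ ∧
    (∀ d, d ≠ d₁ → d ≠ G₁.ferm d₁ →
      G.ferm (dartMap ι₁ d) = dartMap ι₁ (G₁.ferm d)) ∧
    (∀ d, d ≠ d₂ → d ≠ G₂.ferm d₂ →
      G.ferm (dartMap ι₂ d) = dartMap ι₂ (G₂.ferm d))

/-- `H''` is the contraction of the disorder line `{v, w}` of `H`: its vertex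
set is `V(H) ∖ {v, w}` (embedded via `ι`), its disorder pairing is the
restriction of that of `H`, and its fermionic pairing pairs `τ (v, m)` with
`τ (w, m)` for each strand `m` and agrees with `τ` on all other darts. -/
def PreGraph.IsContraction (H H'' : PreGraph q) (v w : H.V) : Prop :=
  ∃ ι : H''.V → H.V,
    Function.Injective ι ∧
    (∀ u : H.V, (∃ u'', ι u'' = u) ↔ (u ≠ v ∧ u ≠ w)) ∧
    (∀ u, ι (H''.dis u) = H.dis (ι u)) ∧
    (∀ m : Fin q, ∃ a b : H''.V × Fin q,
      dartMap ι a = H.ferm (v, m) ∧ dartMap ι b = H.ferm (w, m) ∧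
      H''.ferm a = b) ∧
    (∀ d : H''.V × Fin q,
      (∀ m : Fin q, dartMap ι d ≠ H.ferm (v, m) ∧ dartMap ι d ≠ H.ferm (w, m)) →
      dartMap ι (H''.ferm d) = H.ferm (dartMap ι d))

/-- `HL` is the closure of the side `side ⊆ V(G)` of the graph `G` cut along
the fermionic lines `e₁, e₂`: its vertex set is `{v | side v}` (embedded via
`ι`), its disorder pairing is the restriction of that of `G`, and its
fermionic pairing pairs the `side`-dart of `e₁` with the `side`-dart of `e₂`
and agrees with `τ` on all darts not in `e₁ ∪ e₂`. -/
def Graph.IsSideClose (G : Graph q) (side : G.V → Prop)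
    (e₁ e₂ : Set (G.V × Fin q)) (HL : PreGraph q) : Prop :=
  ∃ ι : HL.V → G.V,
    Function.Injective ι ∧
    (∀ v : G.V, (∃ u, ι u = v) ↔ side v) ∧
    (∀ u, ι (HL.dis u) = G.dis (ι u)) ∧
    (∃ a b : HL.V × Fin q, dartMap ι a ∈ e₁ ∧ dartMap ι b ∈ e₂ ∧
      HL.ferm a = b) ∧
    (∀ d : HL.V × Fin q, dartMap ι d ∉ e₁ ∪ e₂ →
      dartMap ι (HL.ferm d) = G.ferm (dartMap ι d))


/-- The disorder lines, as classes of vertices. -/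
def PreGraph.disSetoid (H : PreGraph q) : Setoid H.V where
  r v w := w = v ∨ w = H.dis v
  iseqv :=
    { refl := fun _ => Or.inl rfl
      symm := by
        rintro v w (rfl | rfl)
        · exact Or.inl rfl
        · exact Or.inr (H.dis_invol v).symm
      trans := by
        rintro u v w (rfl | rfl) (rfl | rfl)
        · exact Or.inl rfl
        · exact Or.inr rfl
        · exact Or.inr rfl
        · exact Or.inl (H.dis_invol u) }

abbrev PreGraph.DisLine (H : PreGraph q) : Type := Quotient H.disSetoid

abbrev PreGraph.Face (H : PreGraph q) : Type :=
  MulAction.orbitRel.Quotient H.faceGroup H.Dart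

/-- The face through a dart. -/
def PreGraph.face (H : PreGraph q) (d : H.Dart) : H.Face := Quotient.mk _ d

theorem PreGraph.face_apply_of_mem (H : PreGraph q) {g : Equiv.Perm H.Dart}
    (hg : g ∈ H.faceGroup) (d : H.Dart) : H.face (g d) = H.face d :=
  Quotient.sound ⟨⟨g, hg⟩, rfl⟩

theorem PreGraph.face_ferm (H : PreGraph q) (d : H.Dart) : H.face (H.ferm d) = H.face d :=
  H.face_apply_of_mem (Subgroup.subset_closure (by simp)) d

theorem PreGraph.face_dis (H : PreGraph q) (v : H.V) (m : Fin q) :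
    H.face (H.dis v, m) = H.face (v, m) :=
  H.face_apply_of_mem (g := H.dishat) (Subgroup.subset_closure (by simp)) (v, m)

theorem PreGraph.two_mul_card_disLine_le (H : PreGraph q) :
    2 * Nat.card H.DisLine ≤ H.nV := by
  have hinj : Function.Injective
      (fun x : H.DisLine × Bool => if x.2 then x.1.out else H.dis x.1.out) := by
    have hmk : ∀ x : H.DisLine × Bool,
        (Quotient.mk _ (if x.2 then x.1.out else H.dis x.1.out) : H.DisLine) = x.1 := by
      rintro ⟨c, b⟩
      cases b
      · exact (Quotient.sound (Or.inr (H.dis_invol _).symm)).trans (Quotient.out_eq c)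
      · exact Quotient.out_eq c
    rintro ⟨c, b⟩ ⟨c', b'⟩ h
    have hc : c = c' := by
      have := congrArg (fun v => (Quotient.mk _ v : H.DisLine)) h
      rwa [hmk, hmk] at this
    subst hc
    have hne := H.dis_fpf c.out
    cases b <;> cases b'
    · rfl
    · exact absurd h hne
    · exact absurd h.symm hne
    · rfl
  have h := Nat.card_le_card_of_injective _ hinj
  rw [Nat.card_prod, Nat.card_eq_fintype_card (α := Bool), Fintype.card_bool] at h
  rw [PreGraph.nV]
  omega

/-- The bipartite incidence graph between disorder lines and faces. -/
def PreGraph.incidence (H : PreGraph q) : SimpleGraph (H.DisLine ⊕ H.Face) :=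
  SimpleGraph.fromEdgeSet
    (Set.range fun x : H.DisLine × Fin q => s(Sum.inl x.1, Sum.inr (H.face (x.1.out, x.2))))

theorem PreGraph.incidence_adj (H : PreGraph q) (v : H.V) (m : Fin q) :
    H.incidence.Adj (Sum.inl (Quotient.mk _ v)) (Sum.inr (H.face (v, m))) := by
  rw [PreGraph.incidence, SimpleGraph.fromEdgeSet_adj]
  refine ⟨⟨(Quotient.mk _ v, m), ?_⟩, by simp⟩
  have hout : H.face ((Quotient.mk H.disSetoid v).out, m) = H.face (v, m) := by
    rcases Quotient.mk_out (s := H.disSetoid) v with h | h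
    · rw [← h]
    · conv_rhs => rw [h]
      rw [H.face_dis]
  simp only [hout]

theorem PreGraph.card_edgeSet_incidence_le (H : PreGraph q) :
    Nat.card H.incidence.edgeSet ≤ Nat.card H.DisLine * q := by
  have hsub : H.incidence.edgeSet ⊆ Set.range
      fun x : H.DisLine × Fin q => s(Sum.inl x.1, Sum.inr (H.face (x.1.out, x.2))) := by
    rw [PreGraph.incidence, SimpleGraph.edgeSet_fromEdgeSet]
    exact Set.sdiff_subset
  calc Nat.card H.incidence.edgeSet ≤ _ := Nat.card_mono (Set.finite_range _) hsub
    _ ≤ Nat.card (H.DisLine × Fin q) := Finite.card_range_le _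
    _ = Nat.card H.DisLine * q := by rw [Nat.card_prod, Nat.card_fin]

theorem PreGraph.incidence_connected (H : PreGraph q) (hc : H.Conn0) :
    H.incidence.Connected := by
  obtain ⟨v₀⟩ := H.nonemptyV
  have hline : ∀ v : H.V,
      H.incidence.Reachable (Sum.inl (Quotient.mk _ v₀)) (Sum.inl (Quotient.mk _ v)) := by
    intro v
    induction hc v₀ v with
    | refl => rfl
    | @tail u w _ huw ih =>
      obtain ⟨m, m', -, h⟩ := huw
      refine (ih.trans (H.incidence_adj u m).reachable).trans ?_
      rw [← H.face_ferm, h]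
      exact (H.incidence_adj w m').symm.reachable
  rw [SimpleGraph.connected_iff_exists_forall_reachable]
  refine ⟨Sum.inl (Quotient.mk _ v₀), ?_⟩
  rintro (c | f)
  · induction c using Quotient.inductionOn with
    | h v => exact hline v
  · induction f using Quotient.inductionOn with
    | h d => exact (hline d.1).trans (H.incidence_adj d.1 d.2).reachable

theorem PreGraph.F_le (H : PreGraph q) (hq : 1 ≤ q) (hc : H.Conn0) :
    H.F ≤ 1 + (q - 1) * (H.nV / 2) := by
  have h₁ := (H.incidence_connected hc).card_vert_le_card_edgeSet_add_one
  rw [Nat.card_sum] at h₁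
  have h₂ := H.card_edgeSet_incidence_le
  have h₃ := H.two_mul_card_disLine_le
  obtain ⟨p, rfl⟩ := Nat.exists_eq_add_of_le' hq
  have h₄ : p * Nat.card H.DisLine ≤ p * (H.nV / 2) := Nat.mul_le_mul_left _ (by omega)
  have h₅ : Nat.card H.DisLine * (p + 1) = p * Nat.card H.DisLine + Nat.card H.DisLine := by ring
  change Nat.card H.Face ≤ _
  rw [Nat.add_sub_cancel]
  omega

/-- A dart colouring constant along fermionic lines and strands is constant on faces. -/
theorem PreGraph.card_le_F_of_invariant (H : PreGraph q) {T : Type} (c : H.Dart → T)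
    (hc : Function.Surjective c) (hferm : ∀ d, c (H.ferm d) = c d)
    (hdis : ∀ v m, c (H.dis v, m) = c (v, m)) : Nat.card T ≤ H.F := by
  have hinv : ∀ g ∈ H.faceGroup, ∀ d, c (g d) = c d := by
    intro g hg
    induction hg using Subgroup.closure_induction with
    | mem g hg =>
      rcases hg with rfl | rfl
      · exact hferm
      · exact fun d => hdis d.1 d.2
    | one => exact fun _ => rfl
    | mul g g' _ _ ih ih' => exact fun d => (ih _).trans (ih' d)
    | inv g _ ih => exact fun d => (ih (g⁻¹ d)).symm.trans (congrArg c (g.apply_symm_apply d))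
  let c' : H.Face → T := Quotient.lift c (by
    rintro a b ⟨g, rfl⟩
    exact hinv g g.2 b)
  refine Nat.card_le_card_of_surjective c' fun t => ?_
  obtain ⟨d, rfl⟩ := hc t
  exact ⟨H.face d, rfl⟩

/-- The fermionic pairing of a cyclic melonic graph: strand `0` joins successive disorder
lines along `σ`, and every other strand joins the two ends of a disorder line. -/
def ringFerm {α : Type} (σ : Equiv.Perm α) (p : ℕ) (d : (α × Bool) × Fin (p + 1)) :
    (α × Bool) × Fin (p + 1) :=
  if d.2 = 0 then
    if d.1.2 then ((σ d.1.1, false), 0) else ((σ.symm d.1.1, true), 0)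
  else ((d.1.1, !d.1.2), d.2)

theorem ringFerm_involutive {α : Type} (σ : Equiv.Perm α) (p : ℕ) :
    Function.Involutive (ringFerm σ p) := by
  rintro ⟨⟨i, b⟩, k⟩
  by_cases hk : k = 0 <;> cases b <;> simp [ringFerm, hk]

theorem ringFerm_fst_snd {α : Type} (σ : Equiv.Perm α) (p : ℕ)
    (d : (α × Bool) × Fin (p + 1)) : (ringFerm σ p d).1.2 = !d.1.2 := by
  obtain ⟨⟨i, b⟩, k⟩ := d
  by_cases hk : k = 0 <;> cases b <;> simp [ringFerm, hk]

/-- The cyclic melonic graph with `n + 1` disorder lines, without its connectedness. -/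
def ringPreGraph (n p : ℕ) : PreGraph (p + 1) where
  V := Fin (n + 1) × Bool
  ferm := (ringFerm_involutive (finRotate (n + 1)) p).toPerm
  dis := Equiv.prodCongr (Equiv.refl _) Equiv.boolNot
  ferm_invol := ringFerm_involutive (finRotate (n + 1)) p
  ferm_fpf d h := by
    have := ringFerm_fst_snd (finRotate (n + 1)) p d
    rw [show ringFerm (finRotate (n + 1)) p d = d from h] at this
    exact Bool.not_ne_self _ this.symm
  dis_invol := by simp
  dis_fpf := by simp [Prod.ext_iff]

theorem PreGraph.adj0_symm (H : PreGraph q) {v w : H.V} : H.adj0 v w → H.adj0 w v := by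
  rintro ⟨m, m', -, h⟩
  exact ⟨m', m, Set.notMem_empty _, by rw [← h, H.ferm_invol]⟩

theorem ringPreGraph_conn0 (n p : ℕ) (hp : 1 ≤ p) : (ringPreGraph n p).Conn0 := by
  obtain ⟨p, rfl⟩ := Nat.exists_eq_add_of_le' hp
  let R := Relation.ReflTransGen (ringPreGraph n (p + 1)).adj0
  have : Std.Symm (ringPreGraph n (p + 1)).adj0 := ⟨fun _ _ => PreGraph.adj0_symm _⟩
  have hsymm : ∀ {v w}, R v w → R w v := fun h => Std.Symm.symm _ _ h
  have hflip : ∀ i : Fin (n + 1), R (i, false) (i, true) := fun i =>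
    .single ⟨1, 1, Set.notMem_empty _, by
      change ringFerm (finRotate (n + 1)) (p + 1) ((i, false), 1) = _
      simp only [ringFerm]
      rfl⟩
  have hstep : ∀ i : Fin (n + 1), R (i, true) (finRotate _ i, false) := fun i =>
    .single ⟨0, 0, Set.notMem_empty _, by
      change ringFerm (finRotate (n + 1)) (p + 1) ((i, true), 0) = _
      simp only [ringFerm]
      rfl⟩
  have hzero : ∀ i : Fin (n + 1), R (0, false) (i, false) := by
    intro i
    induction i using Fin.induction with
    | zero => exact .refl
    | succ i ih =>
      have h := hstep i.castSucc
      rw [finRotate_apply, Fin.coeSucc_eq_succ] at h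
      exact (ih.trans (hflip _)).trans h
  have hall : ∀ v : Fin (n + 1) × Bool, R (0, false) v := by
    rintro ⟨i, b⟩
    cases b
    · exact hzero i
    · exact (hzero i).trans (hflip i)
  exact fun v w => (hsymm (hall v)).trans (hall w)

theorem ringPreGraph_nV (n p : ℕ) : (ringPreGraph n p).nV = 2 * (n + 1) := by
  change Nat.card (Fin (n + 1) × Bool) = _
  simp [mul_comm]

theorem le_ringPreGraph_F (n p : ℕ) : 1 + p * (n + 1) ≤ (ringPreGraph n p).F := by
  let c : (Fin (n + 1) × Bool) × Fin (p + 1) → Option (Fin (n + 1) × Fin p) :=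
    fun d => Fin.cases none (fun k => some (d.1.1, k)) d.2
  have h := (ringPreGraph n p).card_le_F_of_invariant c ?_ ?_ (fun _ _ => rfl)
  · simpa [add_comm, mul_comm] using h
  · rintro (_ | ⟨i, k⟩)
    · exact ⟨((0, false), 0), rfl⟩
    · exact ⟨((i, false), k.succ), rfl⟩
  · rintro ⟨⟨i, b⟩, k⟩
    change c (ringFerm (finRotate (n + 1)) p _) = _
    induction k using Fin.cases <;> cases b <;> simp [ringFerm, c]

/-- For every integer `q ≥ 2` and every even integer
`V ≥ 2`, the maximum of `F(G)` over all SYK graphs `G` with `|V(G)| = V`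
exists and equals `q + (q−1)·(V−2)/2`. -/
theorem syk_max_faces_value (q V : ℕ) (hq : 2 ≤ q) (hV : 2 ≤ V)
    (hVe : Even V) :
    (∀ G : Graph q, G.toPreGraph.nV = V →
        G.toPreGraph.F ≤ q + (q - 1) * ((V - 2) / 2)) ∧
      (∃ G : Graph q, G.toPreGraph.nV = V ∧
        G.toPreGraph.F = q + (q - 1) * ((V - 2) / 2)) := by
  obtain ⟨n, rfl⟩ : ∃ n, V = 2 * (n + 1) := by
    obtain ⟨k, rfl⟩ := hVe
    exact ⟨k - 1, by omega⟩
  obtain ⟨p, rfl⟩ : ∃ p, q = p + 1 := ⟨q - 1, by omega⟩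
  have hval : p + 1 + (p + 1 - 1) * ((2 * (n + 1) - 2) / 2) = 1 + p * (n + 1) := by
    rw [show (2 * (n + 1) - 2) / 2 = n by omega, Nat.add_sub_cancel]
    ring
  have hle : ∀ G : Graph (p + 1), G.toPreGraph.nV = 2 * (n + 1) →
      G.toPreGraph.F ≤ 1 + p * (n + 1) := by
    intro G hG
    have h := G.toPreGraph.F_le (by omega) G.conn
    rwa [hG, Nat.add_sub_cancel, Nat.mul_div_cancel_left _ two_pos] at h
  rw [hval]
  refine ⟨hle, ⟨ringPreGraph n p, ringPreGraph_conn0 n p (by omega)⟩, ringPreGraph_nV n p, ?_⟩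
  exact le_antisymm (hle ⟨_, ringPreGraph_conn0 n p (by omega)⟩ (ringPreGraph_nV n p))
    (le_ringPreGraph_F n p)

end SYK
end

section
/- For every integer q ≥ 2, every SYK graph G with exactly two vertices satisfies F(G) ≤ q, with equality if and only if G is isomorphic to the minimal graph G_min. -/
namespace SYK

variable {q : ℕ}

/-- The face through the dart with strand label `m` at the vertex `a`. -/
def PreGraph.strandFace (H : PreGraph q) (a : H.V) (m : Fin q) :
    MulAction.orbitRel.Quotient H.faceGroup H.Dart :=
  Quotient.mk _ (a, m)

theorem PreGraph.mk_ferm (H : PreGraph q) (d : H.Dart) :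
    (Quotient.mk _ (H.ferm d) : MulAction.orbitRel.Quotient H.faceGroup H.Dart) =
      Quotient.mk _ d :=
  Quotient.sound ⟨⟨H.ferm, Subgroup.subset_closure (by simp)⟩, rfl⟩

theorem PreGraph.mk_dishat (H : PreGraph q) (d : H.Dart) :
    (Quotient.mk _ (H.dishat d) : MulAction.orbitRel.Quotient H.faceGroup H.Dart) =
      Quotient.mk _ d :=
  Quotient.sound ⟨⟨H.dishat, Subgroup.subset_closure (by simp)⟩, rfl⟩

theorem PreGraph.eq_or_eq_dis (H : PreGraph q) (hV : H.nV = 2) (a v : H.V) :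
    v = a ∨ v = H.dis a := by
  by_contra! h
  have hcard : ({v, a, H.dis a} : Finset H.V).card = 3 :=
    Finset.card_eq_three.2 ⟨v, a, H.dis a, h.1, h.2, (H.dis_fpf a).symm, rfl⟩
  have hle := Finset.card_le_univ ({v, a, H.dis a} : Finset H.V)
  rw [PreGraph.nV, Nat.card_eq_fintype_card] at hV
  omega

theorem PreGraph.strandFace_surjective (H : PreGraph q) (hV : H.nV = 2) (a : H.V) :
    Function.Surjective (H.strandFace a) := by
  rintro ⟨v, m⟩
  refine ⟨m, ?_⟩
  rcases H.eq_or_eq_dis hV a v with rfl | rfl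
  · rfl
  · exact (H.mk_dishat (a, m)).symm

/-- Faces preserve strand labels when the two dart involutions coincide. -/
theorem PreGraph.snd_apply_of_mem_faceGroup (H : PreGraph q) (h : H.ferm = H.dishat)
    {g : Equiv.Perm H.Dart} (hg : g ∈ H.faceGroup) (d : H.Dart) : (g d).2 = d.2 := by
  rw [PreGraph.faceGroup, h, Set.pair_eq_singleton] at hg
  induction hg using Subgroup.closure_induction generalizing d with
  | mem x hx => rw [Set.mem_singleton_iff.1 hx]; rfl
  | one => rfl
  | mul x y _ _ hx hy => exact (hx (y d)).trans (hy d)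
  | inv x _ hx => simpa using (hx (x⁻¹ d)).symm

theorem PreGraph.strandFace_injective (H : PreGraph q) (h : H.ferm = H.dishat) (a : H.V) :
    Function.Injective (H.strandFace a) := by
  intro m m' hm
  obtain ⟨⟨g, hg⟩, hgd⟩ := Quotient.exact hm
  exact (congrArg Prod.snd hgd).symm.trans (H.snd_apply_of_mem_faceGroup h hg (a, m'))

theorem PreGraph.F_le_s15 (H : PreGraph q) (hV : H.nV = 2) : H.F ≤ q := by
  obtain ⟨a⟩ := H.nonemptyV
  simpa [PreGraph.F] using Nat.card_le_card_of_surjective _ (H.strandFace_surjective hV a)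

theorem PreGraph.F_eq_iff (H : PreGraph q) (hV : H.nV = 2) :
    H.F = q ↔ H.ferm = H.dishat := by
  constructor
  · intro hF
    have hinj (a : H.V) : Function.Injective (H.strandFace a) :=
      ((Nat.bijective_iff_surjective_and_card _).2
        ⟨H.strandFace_surjective hV a, by rw [Nat.card_fin]; exact hF.symm⟩).injective
    ext1 ⟨a, m⟩
    change _ = (H.dis a, m)
    have hface := H.mk_ferm (a, m)
    have hfix := H.ferm_fpf (a, m)
    generalize H.ferm (a, m) = d at hface hfix
    obtain ⟨v, k⟩ := d
    rcases H.eq_or_eq_dis hV a v with rfl | rfl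
    · exact absurd (congrArg (Prod.mk v) (hinj v hface)) hfix
    · rw [hinj a ((H.mk_dishat (a, k)).symm.trans hface)]
  · intro h
    obtain ⟨a⟩ := H.nonemptyV
    have := Nat.card_eq_of_bijective _
      ⟨H.strandFace_injective h a, H.strandFace_surjective hV a⟩
    rw [Nat.card_fin] at this
    exact this.symm

theorem Graph.IsMin.ferm_eq_dishat {G : Graph q} (hG : G.IsMin) :
    G.ferm = G.toPreGraph.dishat := by
  obtain ⟨a, b, -, hab, hdis, hferm⟩ := hG
  ext1 ⟨v, m⟩
  change _ = (G.dis v, m)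
  rcases hab v with rfl | rfl
  · rw [hferm, hdis]
  · rw [← hferm, G.ferm_invol, ← hdis, G.dis_invol]

theorem Graph.isMin_of_ferm_eq_dishat {G : Graph q} (hV : G.toPreGraph.nV = 2)
    (h : G.ferm = G.toPreGraph.dishat) : G.IsMin := by
  obtain ⟨a⟩ := G.nonemptyV
  exact ⟨a, G.dis a, (G.dis_fpf a).symm, G.toPreGraph.eq_or_eq_dis hV a, rfl,
    fun m => by rw [h]; rfl⟩

theorem Graph.Isomorphic.refl (G : Graph q) : G.Isomorphic G :=
  ⟨Equiv.refl _, fun _ => rfl, fun _ => rfl, fun v => ⟨v, fun _ => rfl⟩⟩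

/-- For every integer `q ≥ 2`, every SYK graph `G` with
exactly two vertices satisfies `F(G) ≤ q`, with equality if and only if `G` is
isomorphic to the minimal graph `G_min`. -/
theorem syk_two_vertex_face_bound (q : ℕ) (hq : 2 ≤ q) (G : Graph q)
    (hV : G.toPreGraph.nV = 2) :
    G.toPreGraph.F ≤ q ∧
      (G.toPreGraph.F = q ↔ ∃ G' : Graph q, G'.IsMin ∧ G.Isomorphic G') := by
  refine ⟨G.toPreGraph.F_le_s15 hV, ?_⟩
  rw [G.toPreGraph.F_eq_iff hV]
  constructor
  · exact fun h => ⟨G, Graph.isMin_of_ferm_eq_dishat hV h, Graph.Isomorphic.refl G⟩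
  · rintro ⟨G', hmin, φ, hferm, hdis, -⟩
    ext1 d
    apply φ.injective
    rw [hferm, hdis, hmin.ferm_eq_dishat]

end SYK
end
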